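/- Let f ∈ SD²_{d−1}(0+) with d ∈ (0,1) and g_δ(t,v) = [f(t+δ, t−δv) − f(t, t−δv)] / f(t+δ, t). Then for every h₀ ∈ (0,1]: lim_{δ↓0} sup_{h₀ ≤ t ≤ 1} | ∫₀^{h₀/δ} |g_δ(t,v)| dv − 1/d | = 0. -/

import Mathlib

open MeasureTheory ProbabilityTheory Filter Set intervalIntegral Real

/-- `p01 F t r = ∂F/∂r (t,r)` -/
noncomputable def p01 (F : ℝ → ℝ → ℝ) (t r : ℝ) : ℝ := deriv (fun x => F t x) r
/-- `p10 F t r = ∂F/∂t (t,r)` -/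
noncomputable def p10 (F : ℝ → ℝ → ℝ) (t r : ℝ) : ℝ := deriv (fun x => F x r) t
/-- `p11 F t r = ∂²F/∂t∂r (t,r)` -/
noncomputable def p11 (F : ℝ → ℝ → ℝ) (t r : ℝ) : ℝ := deriv (fun x => p01 F x r) t
/-- `p02 F t r = ∂²F/∂r² (t,r)` -/
noncomputable def p02 (F : ℝ → ℝ → ℝ) (t r : ℝ) : ℝ := deriv (fun x => p01 F t x) r

/-- `lim_{h↓0} sup_{t∈K} |G h t + c| = 0` for every compact `K ⊂ ℝ`. -/
def UnifDiagLimit (G : ℝ → ℝ → ℝ) (c : ℝ) : Prop :=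
  ∀ K : Set ℝ, IsCompact K → ∀ ε > 0, ∃ h₀ > 0, ∀ h : ℝ, 0 < h → h < h₀ →
    ∀ t ∈ K, |G h t + c| < ε

/-- `F ∈ SR²_ρ(0+)` : a function of smooth variation of index `ρ` at the diagonal. -/
def SmoothVar (F : ℝ → ℝ → ℝ) (ρ : ℝ) : Prop :=
  ContinuousOn (fun p : ℝ × ℝ => F p.1 p.2) {p : ℝ × ℝ | p.2 ≤ p.1} ∧
  ContDiffOn ℝ 2 (fun p : ℝ × ℝ => F p.1 p.2) {p : ℝ × ℝ | p.2 < p.1} ∧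
  (∀ t r : ℝ, r < t → 0 < F t r) ∧
  UnifDiagLimit (fun h t => h * p01 F t (t - h) / F t (t - h)) ρ ∧
  UnifDiagLimit (fun h t => h * p10 F (t + h) t / F (t + h) t) (-ρ) ∧
  UnifDiagLimit (fun h t => h ^ 2 * p11 F t (t - h) / F t (t - h)) (ρ * (ρ - 1)) ∧
  UnifDiagLimit (fun h t => h ^ 2 * p02 F t (t - h) / F t (t - h)) (-(ρ * (ρ - 1)))

open scoped Topology

/-- The open half-plane below the diagonal. -/
def belowDiag : Set (ℝ × ℝ) := {p | p.2 < p.1}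

lemma isOpen_belowDiag : IsOpen belowDiag := isOpen_lt continuous_snd continuous_fst

section Partial

variable {H : ℝ → ℝ → ℝ} {n : WithTop ℕ∞} {t r : ℝ}

lemma differentiableAt_uncurry (hH : ContDiffOn ℝ n (fun p : ℝ × ℝ => H p.1 p.2) belowDiag)
    (hn : n ≠ 0) (h : r < t) : DifferentiableAt ℝ (fun p : ℝ × ℝ => H p.1 p.2) (t, r) :=
  (hH.contDiffAt (isOpen_belowDiag.mem_nhds h)).differentiableAt hn

lemma hasDerivAt_fderiv_right (hH : ContDiffOn ℝ n (fun p : ℝ × ℝ => H p.1 p.2) belowDiag)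
    (hn : n ≠ 0) (h : r < t) :
    HasDerivAt (fun x => H t x) (fderiv ℝ (fun p : ℝ × ℝ => H p.1 p.2) (t, r) (0, 1)) r :=
  (differentiableAt_uncurry hH hn h).hasFDerivAt.comp_hasDerivAt (f := fun x => (t, x)) r
    ((hasDerivAt_const r t).prodMk (hasDerivAt_id r))

lemma hasDerivAt_fderiv_left (hH : ContDiffOn ℝ n (fun p : ℝ × ℝ => H p.1 p.2) belowDiag)
    (hn : n ≠ 0) (h : r < t) :
    HasDerivAt (fun x => H x r) (fderiv ℝ (fun p : ℝ × ℝ => H p.1 p.2) (t, r) (1, 0)) t :=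
  (differentiableAt_uncurry hH hn h).hasFDerivAt.comp_hasDerivAt (f := fun x => (x, r)) t
    ((hasDerivAt_id t).prodMk (hasDerivAt_const t r))

lemma hasDerivAt_p01 (hH : ContDiffOn ℝ n (fun p : ℝ × ℝ => H p.1 p.2) belowDiag)
    (hn : n ≠ 0) (h : r < t) : HasDerivAt (fun x => H t x) (p01 H t r) r :=
  (hasDerivAt_fderiv_right hH hn h).differentiableAt.hasDerivAt

lemma hasDerivAt_p10 (hH : ContDiffOn ℝ n (fun p : ℝ × ℝ => H p.1 p.2) belowDiag)
    (hn : n ≠ 0) (h : r < t) : HasDerivAt (fun x => H x r) (p10 H t r) t :=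
  (hasDerivAt_fderiv_left hH hn h).differentiableAt.hasDerivAt

lemma contDiffOn_p01 (hH : ContDiffOn ℝ 2 (fun p : ℝ × ℝ => H p.1 p.2) belowDiag) :
    ContDiffOn ℝ 1 (fun p : ℝ × ℝ => p01 H p.1 p.2) belowDiag :=
  ((hH.fderiv_of_isOpen isOpen_belowDiag (by norm_num)).clm_apply contDiffOn_const).congr
    fun _ hp => (hasDerivAt_fderiv_right hH two_ne_zero hp).deriv

lemma continuousOn_p10 (hH : ContDiffOn ℝ 1 (fun p : ℝ × ℝ => H p.1 p.2) belowDiag) :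
    ContinuousOn (fun p : ℝ × ℝ => p10 H p.1 p.2) belowDiag :=
  ((hH.continuousOn_fderiv_of_isOpen isOpen_belowDiag le_rfl).clm_apply
    continuousOn_const).congr
    fun _ hp => (hasDerivAt_fderiv_left hH one_ne_zero hp).deriv

/-- Away from the diagonal, a `C¹` function is Lipschitz in its first variable, uniformly. -/
lemma exists_lipschitz_left (hH : ContDiffOn ℝ 1 (fun p : ℝ × ℝ => H p.1 p.2) belowDiag)
    {η : ℝ} (hη : 0 < η) :
    ∃ M, 0 ≤ M ∧ ∀ t ∈ Icc (0 : ℝ) 1, ∀ δ ∈ Icc (0 : ℝ) 1, ∀ r ∈ Icc 0 (t - η),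
      |H (t + δ) r - H t r| ≤ M * δ := by
  let C : Set (ℝ × ℝ) := (Icc 0 2 ×ˢ Icc 0 1) ∩ {p | p.2 ≤ p.1 - η}
  have hC : IsCompact C := (isCompact_Icc.prod isCompact_Icc).inter_right
    (isClosed_le continuous_snd (continuous_fst.sub continuous_const))
  have hCU : C ⊆ belowDiag := fun p hp => by
    have := hp.2
    simp only [mem_ofPred_eq, belowDiag] at this ⊢
    linarith
  obtain ⟨M, hM⟩ := hC.exists_bound_of_continuousOn ((continuousOn_p10 hH).mono hCU)
  refine ⟨max M 0, le_max_right _ _, fun t ht δ hδ r hr => ?_⟩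
  have hmem : ∀ x ∈ Icc t (t + δ), (x, r) ∈ C := fun x hx => by
    refine ⟨⟨⟨?_, ?_⟩, ?_, ?_⟩, ?_⟩ <;> simp only [mem_ofPred_eq] <;>
      linarith [ht.1, ht.2, hδ.1, hδ.2, hr.1, hr.2, hx.1, hx.2]
  have := (convex_Icc t (t + δ)).norm_image_sub_le_of_norm_hasDerivWithin_le
    (f := fun x => H x r) (f' := fun x => p10 H x r) (C := max M 0)
    (fun x hx => (hasDerivAt_p10 hH one_ne_zero (hCU (hmem x hx))).hasDerivWithinAt)
    (fun x hx => (hM _ (hmem x hx)).trans (le_max_left _ _))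
    (left_mem_Icc.2 (by linarith [hδ.1])) (right_mem_Icc.2 (by linarith [hδ.1]))
  simpa [abs_of_nonneg hδ.1] using this

end Partial

/-- If the logarithmic derivative of `G` is at most `q / h`, then `h ^ (-q) * G h` decreases. -/
lemma antitoneOn_rpow_neg_mul {G G' : ℝ → ℝ} {b q : ℝ}
    (hG : ∀ h ∈ Ioo 0 b, HasDerivAt G (G' h) h) (hle : ∀ h ∈ Ioo 0 b, h * G' h ≤ q * G h) :
    AntitoneOn (fun h => h ^ (-q) * G h) (Ioo 0 b) := by
  have hd : ∀ h ∈ Ioo 0 b, HasDerivAt (fun h => h ^ (-q) * G h)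
      (h ^ (-q - 1) * (h * G' h - q * G h)) h := fun h hh => by
    have := (Real.hasDerivAt_rpow_const (p := -q) (Or.inl hh.1.ne')).mul (hG h hh)
    refine this.congr_deriv ?_
    have : h ^ (-q) = h ^ (-q - 1) * h := by
      rw [← Real.rpow_add_one hh.1.ne']; ring_nf
    rw [this]; ring
  refine antitoneOn_of_deriv_nonpos (convex_Ioo 0 b)
    (fun h hh => (hd h hh).continuousAt.continuousWithinAt) ?_ ?_
  · rw [interior_Ioo]
    exact fun h hh => (hd h hh).differentiableAt.differentiableWithinAt
  · rw [interior_Ioo]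
    intro h hh
    rw [(hd h hh).deriv]
    exact mul_nonpos_of_nonneg_of_nonpos (Real.rpow_nonneg hh.1.le _) (by linarith [hle h hh])

lemma UnifDiagLimit.eventually {G : ℝ → ℝ → ℝ} {c : ℝ} (hG : UnifDiagLimit G c) {K : Set ℝ}
    (hK : IsCompact K) {ε : ℝ} (hε : 0 < ε) : ∀ᶠ h in 𝓝[>] 0, ∀ t ∈ K, |G h t + c| < ε := by
  obtain ⟨h₀, hpos, h⟩ := hG K hK ε hε
  filter_upwards [Ioo_mem_nhdsGT hpos] with x hx using h x hx.1 hx.2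

namespace SmoothVar

variable {F : ℝ → ℝ → ℝ} {d : ℝ}

lemma contDiffOn (hF : SmoothVar F d) :
    ContDiffOn ℝ 2 (fun p : ℝ × ℝ => F p.1 p.2) belowDiag := hF.2.1

lemma pos (hF : SmoothVar F d) {t r : ℝ} (h : r < t) : 0 < F t r := hF.2.2.1 t r h

/-- The function `h ↦ F t (t - h)` has the derivative `-p01 F t (t - h)`. -/
lemma hasDerivAt_sub (hF : SmoothVar F d) (t : ℝ) {h : ℝ} (hh : 0 < h) :
    HasDerivAt (fun h => F t (t - h)) (-p01 F t (t - h)) h := by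
  have h1 := hasDerivAt_p01 hF.contDiffOn two_ne_zero (sub_lt_self t hh)
  simpa using h1.comp_const_sub t h

/-- Two-sided control of the logarithmic derivative near the diagonal. -/
lemma exists_log_deriv_bounds (hF : SmoothVar F d) {K : Set ℝ} (hK : IsCompact K) {a b : ℝ}
    (ha : a < d) (hb : d < b) :
    ∃ η > 0, ∀ h ∈ Ioo 0 η, ∀ t ∈ K,
      a * F t (t - h) ≤ h * -p01 F t (t - h) ∧ h * -p01 F t (t - h) ≤ b * F t (t - h) := by
  obtain ⟨η, hη, H⟩ := hF.2.2.2.1 K hK (min (d - a) (b - d)) (by simp [ha, hb])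
  refine ⟨η, hη, fun h hh t ht => ?_⟩
  have h1 := abs_lt.1 (H h hh.1 hh.2 t ht)
  have hp := hF.pos (sub_lt_self t hh.1)
  have h2 : h * p01 F t (t - h) / F t (t - h) < -a := by
    linarith [h1.2, min_le_left (d - a) (b - d)]
  have h3 : -b < h * p01 F t (t - h) / F t (t - h) := by
    linarith [h1.1, min_le_right (d - a) (b - d)]
  rw [div_lt_iff₀ hp] at h2
  rw [lt_div_iff₀ hp] at h3
  constructor <;> linarith

lemma diag_eq_zero (hF : SmoothVar F d) (hd : 0 < d) (t : ℝ) : F t t = 0 := by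
  obtain ⟨η, hη, H⟩ := hF.exists_log_deriv_bounds (isCompact_singleton (x := t))
    (half_lt_self hd) (lt_add_one d)
  have hanti := antitoneOn_rpow_neg_mul (G := fun h => -F t (t - h)) (b := η) (q := d / 2)
    (fun h hh => (hF.hasDerivAt_sub t hh.1).neg)
    (fun h hh => by have := (H h hh t rfl).1; linarith)
  have hcont : Tendsto (fun h => F t (t - h)) (𝓝[>] 0) (𝓝 (F t t)) := by
    have h1 := hF.1 (t, t) (le_refl t)
    refine h1.tendsto.comp (f := fun h : ℝ => (t, t - h)) (tendsto_nhdsWithin_iff.2 ⟨?_, ?_⟩)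
    · have : Continuous fun h : ℝ => (t, t - h) := by fun_prop
      simpa using (this.tendsto 0).mono_left nhdsWithin_le_nhds
    · filter_upwards [self_mem_nhdsWithin] with h hh
      simpa using (mem_Ioi.1 hh).le
  have hη2 : η / 2 ∈ Ioo 0 η := ⟨by linarith, by linarith⟩
  set c := (η / 2) ^ (-(d / 2)) * F t (t - η / 2)
  have hle : ∀ᶠ h in 𝓝[>] (0 : ℝ), F t (t - h) ≤ c * h ^ (d / 2) := by
    filter_upwards [Ioo_mem_nhdsGT hη2.1] with h hh
    have := hanti ⟨hh.1, hh.2.trans hη2.2⟩ hη2 hh.2.le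
    simp only [mul_neg, neg_le_neg_iff] at this
    rwa [Real.rpow_neg hh.1.le, ← div_eq_inv_mul, div_le_iff₀ (Real.rpow_pos_of_pos hh.1 _)]
      at this
  have hzero : Tendsto (fun h : ℝ => c * h ^ (d / 2)) (𝓝[>] 0) (𝓝 0) := by
    have : Continuous fun h : ℝ => c * h ^ (d / 2) :=
      continuous_const.mul (Real.continuous_rpow_const (by positivity))
    simpa [Real.zero_rpow (half_pos hd).ne'] using (this.tendsto 0).mono_left nhdsWithin_le_nhds
  refine le_antisymm (le_of_tendsto_of_tendsto hcont hzero hle) (ge_of_tendsto hcont ?_)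
  filter_upwards [self_mem_nhdsWithin] with h hh using (hF.pos (sub_lt_self t hh)).le

/-- The derivative `p01 F` blows up at the diagonal, uniformly. -/
lemma eventually_lt_neg_p01 (hF : SmoothVar F d) (hd : d ∈ Ioo (0 : ℝ) 1) {K : Set ℝ}
    (hK : IsCompact K) (M : ℝ) : ∀ᶠ h in 𝓝[>] 0, ∀ t ∈ K, M < -p01 F t (t - h) := by
  set q := (d + 1) / 2
  have hq : d < q ∧ q < 1 := by constructor <;> simp only [q] <;> linarith [hd.2]
  obtain ⟨η, hη, H⟩ := hF.exists_log_deriv_bounds hK (half_lt_self hd.1) hq.1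
  have hη2 : η / 2 ∈ Ioo 0 η := ⟨by linarith, by linarith⟩
  obtain ⟨c, hc, hcK⟩ : ∃ c > 0, ∀ t ∈ K, c ≤ F t (t - η / 2) := by
    have hcont : ContinuousOn (fun t => F t (t - η / 2)) K := by
      refine hF.1.comp (f := fun t : ℝ => (t, t - η / 2)) (by fun_prop) fun t _ => ?_
      simpa using hη2.1.le
    rcases K.eq_empty_or_nonempty with rfl | hne
    · exact ⟨1, one_pos, by simp⟩
    · obtain ⟨x, _, hx⟩ := hK.exists_isMinOn hne hcont
      exact ⟨_, hF.pos (sub_lt_self x hη2.1), fun t ht => hx ht⟩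
  set k := d / 2 * ((η / 2) ^ (-q) * c)
  have hk : 0 < k := mul_pos (half_pos hd.1) (mul_pos (Real.rpow_pos_of_pos hη2.1 _) hc)
  have htop : Tendsto (fun h : ℝ => k * h ^ (q - 1)) (𝓝[>] 0) atTop :=
    (tendsto_rpow_neg_nhdsGT_zero (by linarith [hq.2])).const_mul_atTop hk
  filter_upwards [htop.eventually_gt_atTop M, Ioo_mem_nhdsGT hη2.1] with h hM hh t ht
  refine hM.trans_le ?_
  have hh' : h ∈ Ioo 0 η := ⟨hh.1, hh.2.trans hη2.2⟩
  have hanti := antitoneOn_rpow_neg_mul (G := fun h => F t (t - h)) (b := η) (q := q)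
    (fun h hh => hF.hasDerivAt_sub t hh.1) (fun h hh => (H h hh t ht).2) hh' hη2 hh.2.le
  simp only at hanti
  have h1 : (η / 2) ^ (-q) * c ≤ h ^ (-q) * F t (t - h) :=
    (mul_le_mul_of_nonneg_left (hcK t ht) (Real.rpow_nonneg hη2.1.le _)).trans hanti
  have h2 := (H h hh' t ht).1
  have hhq : (0 : ℝ) < h ^ q := Real.rpow_pos_of_pos hh.1 _
  rw [Real.rpow_neg hh.1.le, ← div_eq_inv_mul, le_div_iff₀ hhq] at h1
  rw [Real.rpow_sub_one hh.1.ne', mul_div_assoc', div_le_iff₀ hh.1]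
  calc k * h ^ q = d / 2 * ((η / 2) ^ (-q) * c * h ^ q) := by simp only [k]; ring
    _ ≤ d / 2 * F t (t - h) := mul_le_mul_of_nonneg_left h1 (half_pos hd.1).le
    _ ≤ _ := by linarith

lemma eventually_ratio (hF : SmoothVar F d) (hd : 0 < d) {K : Set ℝ} (hK : IsCompact K)
    {ε : ℝ} (hε : 0 < ε) :
    ∀ᶠ h in 𝓝[>] 0, ∀ t ∈ K, |F t (t - h) / (h * -p01 F t (t - h)) - 1 / d| < ε := by
  have hinv := tendsto_inv₀ (neg_ne_zero.2 hd.ne')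
  obtain ⟨η, hη, H⟩ := Metric.tendsto_nhds_nhds.1 hinv ε hε
  filter_upwards [hF.2.2.2.1.eventually hK hη] with h hh t ht
  have h1 := H (x := h * p01 F t (t - h) / F t (t - h))
    (by simpa [Real.dist_eq] using hh t ht)
  rw [Real.dist_eq, inv_div, ← abs_neg] at h1
  convert h1 using 2
  rw [mul_neg, div_neg, inv_neg]
  ring

/-- The mixed derivative is eventually nonnegative, so `p01 F` increases in its first variable. -/
lemma exists_p01_monotone (hF : SmoothVar F d) (hd : d ∈ Ioo (0 : ℝ) 1) {a b : ℝ} :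
    ∃ η > 0, ∀ r t t' : ℝ, a ≤ t → r < t → t ≤ t' → t' ≤ b → t' < r + η →
      p01 F t r ≤ p01 F t' r := by
  have hneg : 0 < d * (1 - d) := mul_pos hd.1 (by linarith [hd.2])
  obtain ⟨η, hη, H⟩ := hF.2.2.2.2.2.1 (Icc a b) isCompact_Icc _ hneg
  refine ⟨η, hη, fun r t t' hat hrt htt' htb htη => ?_⟩
  have hder : ∀ x ∈ Icc t t', HasDerivAt (fun x => p01 F x r) (p11 F x r) x := fun x hx =>
    hasDerivAt_p10 (contDiffOn_p01 hF.contDiffOn) one_ne_zero (hrt.trans_le hx.1)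
  refine monotoneOn_of_deriv_nonneg (f := fun x => p01 F x r) (convex_Icc t t')
    (fun x hx => (hder x hx).continuousAt.continuousWithinAt)
    (fun x hx => (hder x (interior_subset hx)).differentiableAt.differentiableWithinAt)
    (fun x hx => ?_) (left_mem_Icc.2 htt') (right_mem_Icc.2 htt') htt'
  have hx := interior_subset hx
  have hrx : 0 < x - r := sub_pos.2 (hrt.trans_le hx.1)
  have h1 := abs_lt.1 (H (x - r) hrx (by linarith [hx.2]) x ⟨hat.trans hx.1, hx.2.trans htb⟩)
  simp only [sub_sub_cancel] at h1
  have h2 : 0 < (x - r) ^ 2 * p11 F x r / F x r := by linarith [h1.2, h1.1]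
  rw [div_pos_iff_of_pos_right (hF.pos (hrt.trans_le hx.1)),
    mul_pos_iff_of_pos_left (pow_pos hrx 2)] at h2
  exact h2.le

lemma continuousOn_increment (hF : SmoothVar F d) {t δ b : ℝ} (hδ : 0 < δ) :
    ContinuousOn (fun v => F t (t - δ * v) - F (t + δ) (t - δ * v)) (Icc 0 b) := by
  refine ContinuousOn.sub
    (hF.1.comp (f := fun v => (t, t - δ * v)) (by fun_prop) fun v hv => ?_)
    (hF.1.comp (f := fun v => (t + δ, t - δ * v)) (by fun_prop) fun v hv => ?_) <;>
  · have := mul_nonneg hδ.le hv.1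
    simp only [mem_ofPred_eq]
    linarith

lemma hasDerivAt_increment (hF : SmoothVar F d) {t δ v : ℝ} (hδ : 0 < δ) (hv : 0 < v) :
    HasDerivAt (fun v => F t (t - δ * v) - F (t + δ) (t - δ * v))
      (δ * (p01 F (t + δ) (t - δ * v) - p01 F t (t - δ * v))) v := by
  have hδv := mul_pos hδ hv
  have hl : HasDerivAt (fun v => t - δ * v) (-δ) v := by
    simpa using ((hasDerivAt_id v).const_mul δ).const_sub t
  have h1 := (hasDerivAt_p01 hF.contDiffOn two_ne_zero (r := t - δ * v) (t := t)
    (by linarith)).comp v hl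
  have h2 := (hasDerivAt_p01 hF.contDiffOn two_ne_zero (r := t - δ * v) (t := t + δ)
    (by linarith)).comp v hl
  exact (h1.sub h2).congr_deriv (by ring)

/-- Where the increments of `p01 F` are nonnegative they integrate to an increment of `F`. -/
lemma integral_abs_increment (hF : SmoothVar F d) (hd : 0 < d) {t δ b D : ℝ} (hδ : 0 < δ)
    (hb : 0 ≤ b) (hD : D < 0)
    (hmono : ∀ v ∈ Ioo 0 b, p01 F t (t - δ * v) ≤ p01 F (t + δ) (t - δ * v)) :
    IntervalIntegrable (fun v => |(p01 F (t + δ) (t - δ * v) - p01 F t (t - δ * v)) / D|)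
      volume 0 b ∧
    ∫ v in (0 : ℝ)..b, |(p01 F (t + δ) (t - δ * v) - p01 F t (t - δ * v)) / D| =
      (F (t + δ) t - (F (t + δ) (t - δ * b) - F t (t - δ * b))) / (δ * -D) := by
  have hcont := (hF.continuousOn_increment (t := t) (b := b) hδ).div_const (δ * -D)
  have hderiv : ∀ v ∈ Ioo 0 b, HasDerivAt
      (fun v => (F t (t - δ * v) - F (t + δ) (t - δ * v)) / (δ * -D))
      |(p01 F (t + δ) (t - δ * v) - p01 F t (t - δ * v)) / D| v := fun v hv => by
    refine ((hF.hasDerivAt_increment (t := t) hδ hv.1).div_const (δ * -D)).congr_deriv ?_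
    rw [abs_div, abs_of_nonneg (sub_nonneg.2 (hmono v hv)), abs_of_neg hD,
      mul_div_mul_left _ _ hδ.ne']
  have hinteg : IntervalIntegrable
      (fun v => |(p01 F (t + δ) (t - δ * v) - p01 F t (t - δ * v)) / D|) volume 0 b :=
    (intervalIntegrable_iff_integrableOn_Ioc_of_le hb).2
      (integrableOn_deriv_of_nonneg hcont hderiv fun _ _ => abs_nonneg _)
  refine ⟨hinteg, ?_⟩
  rw [integral_eq_sub_of_hasDerivAt_of_le hb hcont hderiv hinteg]
  simp only [mul_zero, sub_zero, hF.diag_eq_zero hd t]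
  ring

/-- The part of the integral away from the diagonal is controlled by a Lipschitz constant. -/
lemma integral_abs_increment_le (hF : SmoothVar F d) {t δ a b D M : ℝ} (hδ : 0 < δ)
    (ha : 0 < a) (hab : a ≤ b)
    (hM : ∀ v ∈ Icc a b, |p01 F (t + δ) (t - δ * v) - p01 F t (t - δ * v)| ≤ M) :
    IntervalIntegrable (fun v => |(p01 F (t + δ) (t - δ * v) - p01 F t (t - δ * v)) / D|)
      volume a b ∧
    |(∫ v in a..b, |(p01 F (t + δ) (t - δ * v) - p01 F t (t - δ * v)) / D|)| ≤
      M / |D| * (b - a) := by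
  constructor
  · refine ContinuousOn.intervalIntegrable_of_Icc hab (ContinuousOn.abs
      (ContinuousOn.div_const (ContinuousOn.sub ?_ ?_) D))
    · refine (contDiffOn_p01 hF.contDiffOn).continuousOn.comp
        (f := fun v => (t + δ, t - δ * v)) (by fun_prop) fun v hv => ?_
      have := mul_pos hδ (ha.trans_le hv.1)
      simp only [belowDiag, mem_ofPred_eq]
      linarith
    · refine (contDiffOn_p01 hF.contDiffOn).continuousOn.comp
        (f := fun v => (t, t - δ * v)) (by fun_prop) fun v hv => ?_
      have := mul_pos hδ (ha.trans_le hv.1)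
      simp only [belowDiag, mem_ofPred_eq]
      linarith
  · have := norm_integral_le_of_norm_le_const (a := a) (b := b) (C := M / |D|)
      (f := fun v => |(p01 F (t + δ) (t - δ * v) - p01 F t (t - δ * v)) / D|) fun v hv => ?_
    · rwa [Real.norm_eq_abs, abs_of_nonneg (sub_nonneg.2 hab)] at this
    · rw [uIoc_of_le hab] at hv
      rw [Real.norm_eq_abs, abs_abs, abs_div]
      exact div_le_div_of_nonneg_right (hM v ⟨hv.1.le, hv.2⟩) (abs_nonneg D)

end SmoothVar

/-- Lemma 5(d): for every `h₀ ∈ (0,1]`,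
`lim_{δ↓0} sup_{h₀ ≤ t ≤ 1} |∫₀^{h₀/δ} |g_δ(t,v)| dv − 1/d| = 0`. -/
theorem lemma5d (d : ℝ) (hd : d ∈ Set.Ioo (0:ℝ) 1)
    (F : ℝ → ℝ → ℝ) (hF : SmoothVar F d)
    (f : ℝ → ℝ → ℝ) (hf : ∀ t r : ℝ, f t r = p01 F t r) :
    ∀ h₀ ∈ Set.Ioc (0:ℝ) 1, ∀ ε > (0:ℝ), ∃ δ₀ > (0:ℝ), ∀ δ : ℝ, 0 < δ → δ < δ₀ →
      ∀ t ∈ Set.Icc h₀ 1,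
        |(∫ v in (0:ℝ)..(h₀ / δ),
            |(f (t + δ) (t - δ * v) - f t (t - δ * v)) / f (t + δ) t|) - 1 / d| < ε := by
  intro h₀ hh₀ ε hε
  obtain rfl : f = p01 F := funext₂ hf
  obtain ⟨η, hη, hmono⟩ := hF.exists_p01_monotone hd (a := 0) (b := 2)
  set h₁ := min (η / 2) h₀
  have hh₁ : 0 < h₁ := lt_min (half_pos hη) hh₀.1
  have h₁η : h₁ ≤ η / 2 := min_le_left _ _
  have h₁h₀ : h₁ ≤ h₀ := min_le_right _ _
  obtain ⟨M₁, hM₁, hL₁⟩ := exists_lipschitz_left (hF.contDiffOn.of_le one_le_two) hh₁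
  obtain ⟨M₂, hM₂, hL₂⟩ := exists_lipschitz_left (contDiffOn_p01 hF.contDiffOn) hh₁
  have hK := isCompact_Icc (a := (0 : ℝ)) (b := 2)
  suffices hev : ∀ᶠ δ in 𝓝[>] (0 : ℝ), ∀ t ∈ Icc h₀ 1,
      |(∫ v in (0:ℝ)..(h₀ / δ),
        |(p01 F (t + δ) (t - δ * v) - p01 F t (t - δ * v)) / p01 F (t + δ) t|) - 1 / d| < ε by
    obtain ⟨δ₀, hδ₀, h⟩ := mem_nhdsGT_iff_exists_Ioo_subset.1 hev
    exact ⟨δ₀, hδ₀, fun δ hδ hδ' => h ⟨hδ, hδ'⟩⟩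
  filter_upwards [hF.eventually_ratio hd.1 hK (half_pos hε),
    hF.eventually_lt_neg_p01 hd hK (2 * (M₁ + M₂) / ε),
    Ioo_mem_nhdsGT (lt_min (half_pos hη) one_pos)] with δ hratio hblow hδ t ht
  have hδ₁ : δ < 1 := hδ.2.trans_le (min_le_right _ _)
  have hδη : δ < η / 2 := hδ.2.trans_le (min_le_left _ _)
  have hδ := hδ.1
  have ht₀ : 0 ≤ t := hh₀.1.le.trans ht.1
  have htδ : t + δ ∈ Icc (0 : ℝ) 2 := ⟨by linarith, by linarith [ht.2]⟩
  have hratio := hratio _ htδ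
  have hblow := hblow _ htδ
  rw [add_sub_cancel_right] at hratio hblow
  set D := p01 F (t + δ) t
  have hD : 0 < -D := lt_of_le_of_lt (by positivity) hblow
  have hsmall : (M₁ + M₂) / -D < ε / 2 := by
    rw [div_lt_iff₀ hε] at hblow
    rw [div_lt_iff₀ hD]
    linarith
  obtain ⟨hi₁, he₁⟩ := hF.integral_abs_increment hd.1 (t := t) (b := h₁ / δ) hδ
    (div_pos hh₁ hδ).le (neg_pos.1 hD) fun v hv => by
      have h1 := mul_pos hδ hv.1
      have h2 := (lt_div_iff₀' hδ).1 hv.2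
      exact hmono _ _ _ ht₀ (by linarith) (by linarith) htδ.2 (by linarith)
  obtain ⟨hi₂, he₂⟩ := hF.integral_abs_increment_le (t := t) (D := D) (M := M₂ * δ) hδ
    (div_pos hh₁ hδ) (div_le_div_of_nonneg_right h₁h₀ hδ.le) fun v hv => by
      have h1 := (div_le_iff₀' hδ).1 hv.1
      have h2 := (le_div_iff₀' hδ).1 hv.2
      exact hL₂ t ⟨ht₀, ht.2⟩ δ ⟨hδ.le, hδ₁.le⟩ _ ⟨by linarith [ht.1], by linarith⟩
  rw [← integral_add_adjacent_intervals hi₁ hi₂, he₁, mul_div_cancel₀ _ hδ.ne', sub_div]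
  have he₃ : |(F (t + δ) (t - h₁) - F t (t - h₁)) / (δ * -D)| ≤ M₁ / -D := by
    rw [abs_div, abs_of_pos (mul_pos hδ hD), div_le_div_iff₀ (mul_pos hδ hD) hD]
    have := hL₁ t ⟨ht₀, ht.2⟩ δ ⟨hδ.le, hδ₁.le⟩ (t - h₁) ⟨by linarith [ht.1], le_rfl⟩
    calc _ ≤ M₁ * δ * -D := mul_le_mul_of_nonneg_right this hD.le
      _ = _ := by ring
  have he₄ : M₂ * δ / |D| * (h₀ / δ - h₁ / δ) ≤ M₂ / -D := by
    rw [abs_of_neg (neg_pos.1 hD)]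
    calc _ = M₂ / -D * (h₀ - h₁) := by field_simp
      _ ≤ M₂ / -D * 1 := mul_le_mul_of_nonneg_left (by linarith [hh₀.2]) (by positivity)
      _ = _ := mul_one _
  rw [add_div] at hsmall
  have a := abs_lt.1 hratio
  have b := abs_le.1 he₃
  have c := abs_le.1 (he₂.trans he₄)
  rw [abs_lt]
  constructor <;> linarith
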